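/- Let Γ = ⟨α, β⟩ with α, β coprime, 2 ≤ α < β, α even and β odd. Then: (i) the total number of sets Δ ⊆ ℕ with 0 ∈ Δ and Δ + Γ ⊆ Δ that are selfdual equals C(α/2 + (β−1)/2, α/2); (ii) for 0 ≤ ℓ ≤ α/2 − 1, the number of such selfdual Δ whose minimal system of generators has exactly 2ℓ + 1 elements equals C(α/2 − 1, ℓ) · C((β−1)/2, ℓ); (iii) for 1 ≤ ℓ ≤ α/2, the number with exactly 2ℓ elements equals C(α/2 − 1, ℓ − 1) · C((β−1)/2, ℓ). -/

import Mathlib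

/-- The numerical semigroup `⟨α, β⟩ = {pα + qβ : p, q ∈ ℕ}`, viewed inside `ℤ`. -/
def Gamma (α β : ℕ) : Set ℤ := {x : ℤ | ∃ p q : ℕ, x = (p : ℤ) * α + (q : ℤ) * β}

/-- The dual `Δ* = {c ∈ ℤ : c + Δ ⊆ ⟨α,β⟩}` of an `⟨α,β⟩`-semimodule. -/
def dualSet (α β : ℕ) (Δ : Set ℤ) : Set ℤ := {c : ℤ | ∀ x ∈ Δ, c + x ∈ Gamma α β}

/-- A normalized `⟨α,β⟩`-semimodule: a subset of `ℕ` containing `0`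
with `Δ + Γ ⊆ Δ`. -/
def IsNormalizedSemimodule (α β : ℕ) (Δ : Set ℤ) : Prop :=
  (0 : ℤ) ∈ Δ ∧ (∀ x ∈ Δ, 0 ≤ x) ∧ ∀ x ∈ Δ, ∀ γ ∈ Gamma α β, x + γ ∈ Δ

/-- `Δ` is selfdual if `Δ*` is a shift of `Δ`. -/
def IsSelfdual (α β : ℕ) (Δ : Set ℤ) : Prop :=
  ∃ c : ℤ, dualSet α β Δ = (fun x => c + x) '' Δ

/-- `E` is the minimal system of generators of `Δ`: it generates `Δ`
(`⋃_{x∈E}(x+Γ) = Δ`) and no proper subset of it generates `Δ`. -/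
def IsMinGenSet (α β : ℕ) (Δ : Set ℤ) (E : Finset ℤ) : Prop :=
  (↑E ⊆ Δ) ∧ (⋃ x ∈ (E : Set ℤ), (fun γ => x + γ) '' Gamma α β) = Δ ∧
    ∀ F : Finset ℤ, F ⊂ E → (⋃ x ∈ (F : Set ℤ), (fun γ => x + γ) '' Gamma α β) ≠ Δ

/-- bounded sequences supported on `[0,n)` with sum at most `b` -/
def BB (n b : ℕ) : Set (ℕ → ℕ) := {c | (∀ j, n ≤ j → c j = 0) ∧ ∑ j ∈ Finset.range n, c j ≤ b}

/-- the number of nonzero entries -/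
def nz (n : ℕ) (c : ℕ → ℕ) : ℕ := ((Finset.range n).filter (fun j => c j ≠ 0)).card

def AA (n b l : ℕ) : Set (ℕ → ℕ) := {c | c ∈ BB n b ∧ nz n c = l}
def JJ (n b l : ℕ) : Set (ℕ → ℕ) := {c | c ∈ BB (n+1) b ∧ nz (n+1) c = l ∧ c n ≠ 0}

lemma nz_succ (n : ℕ) (c : ℕ → ℕ) : nz (n+1) c = nz n c + if c n ≠ 0 then 1 else 0 := by
  unfold nz
  rw [Finset.range_add_one, Finset.filter_insert]
  split_ifs with h
  · rw [Finset.card_insert_of_notMem (by simp)]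
  · simp

lemma nz_congr (n : ℕ) (c c' : ℕ → ℕ) (h : ∀ j < n, c j = c' j) : nz n c = nz n c' := by
  unfold nz
  congr 1
  apply Finset.filter_congr
  intro j hj
  rw [h j (Finset.mem_range.1 hj)]

lemma sum_upd (n : ℕ) (c : ℕ → ℕ) (v : ℕ) :
    ∑ j ∈ Finset.range n, Function.update c n v j = ∑ j ∈ Finset.range n, c j := by
  apply Finset.sum_congr rfl
  intro j hj
  rw [Function.update_of_ne (Finset.mem_range.1 hj).ne]

lemma nz_upd (n : ℕ) (c : ℕ → ℕ) (v : ℕ) : nz n (Function.update c n v) = nz n c := by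
  apply nz_congr
  intro j hj
  rw [Function.update_of_ne hj.ne]

lemma BB_finite (n b : ℕ) : (BB n b).Finite := by
  have : (BB n b) ⊆ (fun (g : Fin n → Fin (b+1)) (j : ℕ) => if h : j < n then (g ⟨j, h⟩ : ℕ) else 0) '' Set.univ := by
    intro c hc
    have hle : ∀ j < n, c j < b + 1 := fun j hj =>
      Nat.lt_succ_of_le ((Finset.single_le_sum (f := c) (fun _ _ => Nat.zero_le _) (Finset.mem_range.2 hj)).trans hc.2)
    refine ⟨fun j => ⟨c j, hle j j.2⟩, trivial, ?_⟩
    funext j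
    by_cases h : j < n
    · simp [h]
    · simp [h, hc.1 j (by omega)]
  exact (Set.toFinite _).subset this

lemma AA_finite (n b l : ℕ) : (AA n b l).Finite := (BB_finite n b).subset fun _ h => h.1
lemma JJ_finite (n b l : ℕ) : (JJ n b l).Finite := (BB_finite (n+1) b).subset fun _ h => h.1

lemma BB_zero_last (n b : ℕ) (c : ℕ → ℕ) (h : c n = 0) : c ∈ BB (n+1) b ↔ c ∈ BB n b := by
  unfold BB
  simp only [Set.mem_ofPred_eq, Finset.sum_range_succ, h, add_zero]
  constructor
  · rintro ⟨h1, h2⟩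
    refine ⟨fun j hj => ?_, h2⟩
    rcases hj.eq_or_lt with rfl | hj
    · exact h
    · exact h1 j hj
  · rintro ⟨h1, h2⟩
    exact ⟨fun j hj => h1 j (by omega), h2⟩

lemma incr_inj (n : ℕ) : Function.Injective (fun c : ℕ → ℕ => Function.update c n (c n + 1)) := by
  intro c c' h
  funext j
  have := congrFun h j
  by_cases hj : j = n
  · subst hj; simpa using this
  · simpa [hj] using this

lemma BB_incr (n b : ℕ) (c : ℕ → ℕ) :
    Function.update c n (c n + 1) ∈ BB (n+1) (b+1) ↔ c ∈ BB (n+1) b := by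
  unfold BB
  simp only [Set.mem_ofPred_eq, Finset.sum_range_succ, sum_upd, Function.update_self]
  refine and_congr ?_ (by omega)
  refine forall_congr' fun j => ?_
  refine imp_congr_right fun hj => ?_
  rw [Function.update_of_ne (by omega)]

lemma exists_decr (n : ℕ) (c : ℕ → ℕ) (h : c n ≠ 0) :
    ∃ c', Function.update c' n (c' n + 1) = c := by
  refine ⟨Function.update c n (c n - 1), ?_⟩
  funext j
  by_cases hj : j = n
  · subst hj; simp; omega
  · simp [hj]

lemma BB_card (n b : ℕ) : (BB n b).ncard = (n + b).choose n := by
  induction n generalizing b with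
  | zero =>
    have : BB 0 b = {fun _ => 0} := by
      ext c; simp [BB, funext_iff]
    rw [this]; simp
  | succ n ih =>
    induction b with
    | zero =>
      have : BB (n+1) 0 = BB n 0 := by
        ext c
        constructor
        · intro h
          refine (BB_zero_last n 0 c ?_).1 h
          have := h.2
          rw [Finset.sum_range_succ] at this
          omega
        · intro h
          exact (BB_zero_last n 0 c (h.1 n le_rfl)).2 h
      rw [this, ih]; simp
    | succ b ihb =>
      have : BB (n+1) (b+1) = BB n (b+1) ∪ (fun c : ℕ → ℕ => Function.update c n (c n + 1)) '' BB (n+1) b := by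
        ext c
        simp only [Set.mem_union, Set.mem_image]
        constructor
        · intro h
          by_cases h0 : c n = 0
          · left; exact (BB_zero_last n _ c h0).1 h
          · right
            obtain ⟨c', rfl⟩ := exists_decr n c h0
            exact ⟨c', (BB_incr n b c').1 h, rfl⟩
        · rintro (h | ⟨c', h, rfl⟩)
          · exact (BB_zero_last n _ c (h.1 n le_rfl)).2 h
          · exact (BB_incr n b c').2 h
      rw [this, Set.ncard_union_eq _ (BB_finite _ _) ((BB_finite _ _).image _),
        Set.ncard_image_of_injective _ (incr_inj n), ih, ihb]
      · have e1 : n + 1 + (b + 1) = (n + (b+1)) + 1 := by ring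
        have e2 : n + 1 + b = n + (b + 1) := by ring
        rw [e1, Nat.choose_succ_succ, e2]
      · rw [Set.disjoint_left]
        rintro c h ⟨c', _, rfl⟩
        have := h.1 n le_rfl
        simp at this

lemma JJ_card_aux (n l : ℕ) (hA : ∀ b, (AA n b l).ncard = n.choose l * b.choose l) (b : ℕ) :
    (JJ n b (l+1)).ncard = n.choose l * b.choose (l+1) := by
  induction b with
  | zero =>
    have : JJ n 0 (l+1) = ∅ := by
      ext c
      simp only [Set.mem_empty_iff_false, iff_false]
      rintro ⟨h1, _, h3⟩
      have := h1.2
      rw [Finset.sum_range_succ] at this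
      omega
    rw [this]; simp
  | succ b ih =>
    have : JJ n (b+1) (l+1) = (fun c : ℕ → ℕ => Function.update c n (c n + 1)) '' AA n b l ∪
        (fun c : ℕ → ℕ => Function.update c n (c n + 1)) '' JJ n b (l+1) := by
      rw [← Set.image_union]
      ext c
      simp only [Set.mem_image]
      constructor
      · rintro ⟨h1, h2, h3⟩
        obtain ⟨c', rfl⟩ := exists_decr n c h3
        refine ⟨c', ?_, rfl⟩
        rw [BB_incr] at h1
        rw [nz_succ, nz_upd] at h2
        simp at h2
        by_cases h0 : c' n = 0
        · left; exact ⟨(BB_zero_last n b c' h0).1 h1, h2⟩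
        · right; refine ⟨h1, ?_, h0⟩
          rw [nz_succ, h2]; simp [h0]
      · rintro ⟨c', h, rfl⟩
        refine ⟨?_, ?_, by simp⟩
        · rw [BB_incr]
          rcases h with h | h
          · exact (BB_zero_last n b c' (h.1.1 n le_rfl)).2 h.1
          · exact h.1
        · rw [nz_succ, nz_upd]
          rcases h with h | h
          · simp [h.2]
          · have := h.2.1
            rw [nz_succ] at this
            simp [h.2.2] at this
            simp [this]
    rw [this, Set.ncard_union_eq _ ((AA_finite _ _ _).image _) ((JJ_finite _ _ _).image _),
      Set.ncard_image_of_injective _ (incr_inj n), Set.ncard_image_of_injective _ (incr_inj n), ih, hA,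
      Nat.choose_succ_succ]
    · ring
    · rw [Set.disjoint_image_iff (incr_inj n), Set.disjoint_left]
      rintro c h h'
      exact h'.2.2 (h.1.1 n le_rfl)

lemma AA_card (n b l : ℕ) : (AA n b l).ncard = n.choose l * b.choose l := by
  induction n generalizing b l with
  | zero =>
    cases l with
    | zero =>
      have : AA 0 b 0 = {fun _ => 0} := by
        ext c; simp [AA, BB, nz, funext_iff]
      rw [this]; simp
    | succ l =>
      have : AA 0 b (l+1) = ∅ := by
        ext c; simp [AA, nz]
      rw [this]; simp
  | succ n ih =>
    have : AA (n+1) b l = AA n b l ∪ JJ n b l := by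
      ext c
      constructor
      · intro h
        by_cases h0 : c n = 0
        · left
          refine ⟨(BB_zero_last n b c h0).1 h.1, ?_⟩
          have := h.2
          rw [nz_succ] at this
          simpa [h0] using this
        · right; exact ⟨h.1, h.2, h0⟩
      · rintro (h | h)
        · have h0 := h.1.1 n le_rfl
          refine ⟨(BB_zero_last n b c h0).2 h.1, ?_⟩
          rw [nz_succ, h.2]; simp [h0]
        · exact ⟨h.1, h.2.1⟩
    rw [this, Set.ncard_union_eq _ (AA_finite _ _ _) (JJ_finite _ _ _), ih]
    · cases l with
      | zero =>
        have : JJ n b 0 = ∅ := by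
          ext c
          simp only [Set.mem_empty_iff_false, iff_false]
          rintro ⟨_, h2, h3⟩
          rw [nz_succ] at h2
          simp [h3] at h2
        rw [this]; simp
      | succ l =>
        rw [JJ_card_aux n l (fun b => ih b l), Nat.choose_succ_succ n l]
        ring
    · rw [Set.disjoint_left]
      rintro c h h'
      exact h'.2.2 (h.1.1 n le_rfl)

lemma JJ_card (n b l : ℕ) : (JJ n b (l+1)).ncard = n.choose l * b.choose (l+1) :=
  JJ_card_aux n l (fun b => AA_card n b l) b

lemma ncard_eq_of_rel {A B : Type*} (s : Set A) (t : Set B) (R : A → B → Prop)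
    (h1 : ∀ x ∈ s, ∃ y ∈ t, R x y) (h2 : ∀ y ∈ t, ∃ x ∈ s, R x y)
    (h3 : ∀ x ∈ s, ∀ y y', R x y → R x y' → y = y')
    (h4 : ∀ x ∈ s, ∀ x' ∈ s, ∀ y, R x y → R x' y → x = x') : s.ncard = t.ncard := by
  choose f hf hR using h1
  refine Set.ncard_congr f hf ?_ ?_
  · intro x x' hx hx' h
    exact h4 x hx x' hx' _ (hR x hx) (h ▸ hR x' hx')
  · intro y hy
    obtain ⟨x, hx, hxy⟩ := h2 y hy
    exact ⟨x, hx, h3 x hx _ _ (hR x hx) hxy⟩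

lemma exists_rep (α β : ℕ) (hα : 0 < α) (hcop : Nat.Coprime α β) (x : ℤ) :
    ∃ p q : ℤ, x = p * α + q * β ∧ 0 ≤ q ∧ q < α := by
  have h := Nat.isCoprime_iff_coprime.2 hcop
  obtain ⟨u, v, huv⟩ := h
  have hα' : (0 : ℤ) < α := by exact_mod_cast hα
  refine ⟨x * u + ((x * v) / α) * β, (x * v) % α, ?_, Int.emod_nonneg _ hα'.ne', Int.emod_lt_of_pos _ hα'⟩
  have := Int.emod_add_mul_ediv (x * v) α
  linear_combination (-x) * huv - (β : ℤ) * this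

lemma rep_eq (α β : ℕ) (hα : 0 < α) (hcop : Nat.Coprime α β) (p q p' q' : ℤ)
    (h : p * α + q * β = p' * α + q' * β) : ∃ k : ℤ, q' = q + k * α ∧ p' = p - k * β := by
  have hα' : (α : ℤ) ≠ 0 := by exact_mod_cast hα.ne'
  have h1 : (α : ℤ) ∣ (q' - q) * β := ⟨p - p', by linear_combination -h⟩
  have h2 : (α : ℤ) ∣ q' - q := (Nat.isCoprime_iff_coprime.2 hcop).dvd_of_dvd_mul_right h1
  obtain ⟨k, hk⟩ := h2
  refine ⟨k, by linear_combination hk, ?_⟩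
  apply mul_right_cancel₀ hα'
  linear_combination -h - (β : ℤ) * hk

lemma mem_Gamma_iff (α β : ℕ) (hα : 0 < α) (hcop : Nat.Coprime α β) (p q : ℤ)
    (h0 : 0 ≤ q) (h1 : q < α) : p * α + q * β ∈ Gamma α β ↔ 0 ≤ p := by
  constructor
  · rintro ⟨p', q', h⟩
    obtain ⟨k, hk1, hk2⟩ := rep_eq α β hα hcop _ _ _ _ h
    have hk : 0 ≤ k := by
      by_contra hk
      have : k * (α : ℤ) ≤ (-1) * α := mul_le_mul_of_nonneg_right (by omega) (by omega)
      omega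
    have : 0 ≤ k * (β : ℤ) := by positivity
    omega
  · intro h
    exact ⟨p.toNat, q.toNat, by rw [Int.toNat_of_nonneg h, Int.toNat_of_nonneg h0]⟩

lemma Gamma_symm (α β : ℕ) (hα : 0 < α) (hcop : Nat.Coprime α β) (x : ℤ) :
    x ∈ Gamma α β ↔ ((α : ℤ) * β - α - β) - x ∉ Gamma α β := by
  obtain ⟨p, q, rfl, h0, h1⟩ := exists_rep α β hα hcop x
  have : ((α : ℤ) * β - α - β) - (p * α + q * β) = (-1 - p) * α + (α - 1 - q) * β := by ring
  rw [this, mem_Gamma_iff α β hα hcop p q h0 h1, mem_Gamma_iff α β hα hcop _ _ (by omega) (by omega)]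
  omega

lemma dual_iff (α β : ℕ) (hα : 0 < α) (hcop : Nat.Coprime α β) (Δ : Set ℤ)
    (hΔ : IsNormalizedSemimodule α β Δ) (c : ℤ) :
    c ∈ dualSet α β Δ ↔ ((α : ℤ) * β - α - β) - c ∉ Δ := by
  constructor
  · intro h hc
    have := h _ hc
    rw [Gamma_symm α β hα hcop] at this
    apply this
    exact ⟨0, 0, by push_cast; ring⟩
  · intro h x hx
    rw [Gamma_symm α β hα hcop]
    intro hg
    apply h
    have := hΔ.2.2 x hx _ hg
    convert this using 1
    ring

lemma selfdual_iff (α β : ℕ) (hα : 0 < α) (hcop : Nat.Coprime α β) (Δ : Set ℤ)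
    (hΔ : IsNormalizedSemimodule α β Δ) :
    IsSelfdual α β Δ ↔ ∃ s : ℤ, ∀ x, x ∈ Δ ↔ s - x ∉ Δ := by
  constructor
  · rintro ⟨c, hc⟩
    refine ⟨((α : ℤ) * β - α - β) - c, fun x => ?_⟩
    have h1 : c + x ∈ dualSet α β Δ ↔ x ∈ Δ := by
      rw [hc]; simp
    rw [← h1, dual_iff α β hα hcop Δ hΔ, sub_sub _ c x]
  · rintro ⟨s, hs⟩
    refine ⟨((α : ℤ) * β - α - β) - s, ?_⟩
    ext y
    rw [dual_iff α β hα hcop Δ hΔ]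
    constructor
    · intro h
      refine ⟨y - (((α : ℤ) * β - α - β) - s), ?_, by ring⟩
      rw [hs]
      convert h using 2
      ring
    · rintro ⟨x, hx, rfl⟩
      rw [hs] at hx
      convert hx using 2
      ring

/-- boundary functions -/
structure IsS (α β : ℕ) (d : ℤ → ℤ) : Prop where
  anti : ∀ q, d (q + 1) ≤ d q
  per : ∀ q, d (q + α) = d q - β
  sym : ∀ q, d (-1 - q) = β - d q

def RR (α β : ℕ) (Δ : Set ℤ) (t : ℤ) (d : ℤ → ℤ) : Prop :=
  ∀ p q : ℤ, p * α + q * β - t ∈ Δ ↔ d q ≤ p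

lemma IsS.perk {α β : ℕ} {d : ℤ → ℤ} (h : IsS α β d) (q k : ℤ) : d (q + k * α) = d q - k * β := by
  induction k with
  | zero => simp
  | succ k ih =>
    have := h.per (q + k * α)
    rw [ih] at this
    rw [show q + ((k : ℤ) + 1) * α = q + k * α + α by ring, this]; ring
  | pred k ih =>
    have := h.per (q + (-(k : ℤ) - 1) * α)
    rw [show q + (-(k : ℤ) - 1) * α + α = q + (-(k : ℤ)) * α by ring, ih] at this
    linear_combination -this

lemma rep_le {α β : ℕ} (hα : 0 < α) (hcop : Nat.Coprime α β) {d : ℤ → ℤ} (h : IsS α β d) (p q p' q' : ℤ)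
    (he : p * α + q * β = p' * α + q' * β) : d q ≤ p ↔ d q' ≤ p' := by
  obtain ⟨k, rfl, rfl⟩ := rep_eq α β hα hcop _ _ _ _ he
  rw [h.perk]; omega

/-- existence of boundary function for a selfdual module -/
lemma exists_d (α β : ℕ) (hα : 0 < α) (hcop : Nat.Coprime α β) (hαe : Even α) (hβ : Odd β) (Δ : Set ℤ)
    (hΔ : IsNormalizedSemimodule α β Δ) (hs : IsSelfdual α β Δ) :
    ∃ t d, IsS α β d ∧ RR α β Δ t d := by
  rw [selfdual_iff α β hα hcop Δ hΔ] at hs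
  obtain ⟨s, hs⟩ := hs
  have hα' : (0 : ℤ) < α := by exact_mod_cast hα
  have hsodd : Odd s := by
    rw [← Int.not_even_iff_odd]
    rintro ⟨r, hr⟩
    have := hs r
    rw [hr, add_sub_cancel_right] at this
    tauto
  have hk : Odd ((α : ℤ) * β - α - β) := by
    have h1 : Even (α : ℤ) := by exact_mod_cast hαe
    have h2 : Odd (β : ℤ) := by exact_mod_cast hβ
    exact ((h1.mul_right _).sub h1).sub_odd h2
  obtain ⟨t, ht⟩ := hk.sub_odd hsodd
  have hA : ∀ x ∈ Δ, x + α ∈ Δ := fun x hx => hΔ.2.2 x hx _ ⟨1, 0, by simp⟩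
  have hB : ∀ x ∈ Δ, x + β ∈ Δ := fun x hx => hΔ.2.2 x hx _ ⟨0, 1, by simp⟩
  have hAk : ∀ (k : ℕ), ∀ x ∈ Δ, x + k * α ∈ Δ := fun k x hx => hΔ.2.2 x hx _ ⟨k, 0, by simp⟩
  have hbd : ∀ q p : ℤ, p * α + q * β - t ∈ Δ → -(|q * β - t|) ≤ p := by
    intro q p h
    have h1 := hΔ.2.1 _ h
    have h2 := le_abs_self (q * β - t)
    have h3 := abs_nonneg (q * β - t)
    by_contra hc
    have : p * (α : ℤ) ≤ p := by nlinarith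
    omega
  have hex : ∀ q : ℤ, ∃ p : ℤ, p * α + q * β - t ∈ Δ := by
    intro q
    by_contra! h
    have h1 : ∀ p : ℤ, s - (p * α + q * β - t) ∈ Δ := by
      intro p
      have := h p
      rw [hs] at this
      exact not_not.1 this
    have h2 := hΔ.2.1 _ (h1 (|s - q * β + t| + 1))
    have h3 := le_abs_self (s - q * β + t)
    have h4 := abs_nonneg (s - q * β + t)
    nlinarith
  have hmin : ∀ q : ℤ, ∃ m : ℤ, ∀ p : ℤ, p * α + q * β - t ∈ Δ ↔ m ≤ p := by
    intro q
    obtain ⟨m, hm1, hm2⟩ := Int.exists_least_of_bdd (P := fun p => p * α + q * β - t ∈ Δ)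
      ⟨_, fun p hp => hbd q p hp⟩ (hex q)
    refine ⟨m, fun p => ⟨fun hp => hm2 p hp, fun hp => ?_⟩⟩
    obtain ⟨k, hk⟩ := Int.le.dest hp
    have := hAk k _ hm1
    convert this using 1
    rw [← hk]; ring
  choose d hd using hmin
  refine ⟨t, d, ⟨?_, ?_, ?_⟩, fun p q => hd q p⟩
  · intro q
    rw [← hd]
    have := hB _ ((hd q (d q)).2 le_rfl)
    convert this using 1
    ring
  · intro q
    have key : ∀ p, d (q + α) ≤ p ↔ d q - β ≤ p := by
      intro p
      rw [← hd, sub_le_iff_le_add, ← hd]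
      rw [show p * (α : ℤ) + (q + α) * β - t = (p + β) * α + q * β - t by ring]
    exact le_antisymm ((key _).2 le_rfl) ((key _).1 le_rfl)
  · intro q
    have key : ∀ p, d (-1 - q) ≤ p ↔ β - d q ≤ p := by
      intro p
      rw [← hd, hs]
      rw [show s - (p * (α : ℤ) + (-1 - q) * β - t) = (β - 1 - p) * α + q * β - t by
        linear_combination -ht, hd]
      omega
    exact le_antisymm ((key _).2 le_rfl) ((key _).1 le_rfl)

lemma RR_symm {α β : ℕ} (hα : 0 < α) (hcop : Nat.Coprime α β) {Δ : Set ℤ} {t : ℤ} {d : ℤ → ℤ}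
    (hd : IsS α β d) (hR : RR α β Δ t d) (x : ℤ) :
    x ∈ Δ ↔ ((α : ℤ) * β - α - β - 2 * t) - x ∉ Δ := by
  obtain ⟨p, q, hpq, -, -⟩ := exists_rep α β hα hcop (x + t)
  have e1 : x = p * α + q * β - t := by linarith
  have e2 : ((α : ℤ) * β - α - β - 2 * t) - x = (β - 1 - p) * α + (-1 - q) * β - t := by
    rw [e1]; ring
  rw [e2, e1, hR, hR, hd.sym]
  omega

lemma shift_zero {Δ : Set ℤ} (h0 : (0 : ℤ) ∈ Δ) (hn : ∀ x ∈ Δ, 0 ≤ x) (s s' : ℤ)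
    (h : ∀ x, x ∈ Δ ↔ s - x ∉ Δ) (h' : ∀ x, x ∈ Δ ↔ s' - x ∉ Δ) : s ≤ s' := by
  have h1 : s - s' + 0 ∈ Δ := by
    rw [h]
    have := (h' 0).1 h0
    convert this using 2
    ring
  have := hn _ h1
  have h1 : s' - s + 0 ∈ Δ := by
    rw [h']
    have := (h 0).1 h0
    convert this using 2
    ring
  have := hn _ h1
  omega

lemma d_unique {α β : ℕ} (hα : 0 < α) (hcop : Nat.Coprime α β) {Δ : Set ℤ}
    (hΔ : IsNormalizedSemimodule α β Δ) {t t' : ℤ} {d d' : ℤ → ℤ}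
    (hd : IsS α β d) (hR : RR α β Δ t d) (hd' : IsS α β d') (hR' : RR α β Δ t' d') : d = d' := by
  have h1 := shift_zero hΔ.1 hΔ.2.1 _ _ (RR_symm hα hcop hd hR) (RR_symm hα hcop hd' hR')
  have h2 := shift_zero hΔ.1 hΔ.2.1 _ _ (RR_symm hα hcop hd' hR') (RR_symm hα hcop hd hR)
  have : t = t' := by omega
  subst this
  funext q
  have key : ∀ p, d q ≤ p ↔ d' q ≤ p := fun p => by rw [← hR, ← hR']
  exact le_antisymm ((key _).2 le_rfl) ((key _).1 le_rfl)

lemma Delta_unique {α β : ℕ} (hα : 0 < α) (hcop : Nat.Coprime α β) {Δ Δ' : Set ℤ}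
    (hΔ : IsNormalizedSemimodule α β Δ) (hΔ' : IsNormalizedSemimodule α β Δ') {t t' : ℤ} {d : ℤ → ℤ}
    (hR : RR α β Δ t d) (hR' : RR α β Δ' t' d) : Δ = Δ' := by
  have key : ∀ x, x - t ∈ Δ ↔ x - t' ∈ Δ' := by
    intro x
    obtain ⟨p, q, rfl, -, -⟩ := exists_rep α β hα hcop x
    rw [hR, hR']
  have h1 := hΔ'.2.1 _ ((key t).1 (by simpa using hΔ.1))
  have h2 := hΔ.2.1 _ ((key t').2 (by simpa using hΔ'.1))
  have : t = t' := by omega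
  subst this
  ext x
  simpa using key (x + t)

lemma IsS.antitone {α β : ℕ} {d : ℤ → ℤ} (h : IsS α β d) : Antitone d :=
  antitone_int_of_succ_le h.anti

lemma exists_Delta {α β : ℕ} (hα : 0 < α) (hcop : Nat.Coprime α β) {d : ℤ → ℤ} (hd : IsS α β d) :
    ∃ Δ t, IsNormalizedSemimodule α β Δ ∧ IsSelfdual α β Δ ∧ RR α β Δ t d := by
  let D : Set ℤ := {x | ∃ p q : ℤ, x = p * α + q * β ∧ d q ≤ p}
  have hD : ∀ p q : ℤ, p * α + q * β ∈ D ↔ d q ≤ p := by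
    intro p q
    constructor
    · rintro ⟨p', q', he, h⟩
      exact (rep_le hα hcop hd _ _ _ _ he).2 h
    · intro h; exact ⟨p, q, rfl, h⟩
  have hα' : (0 : ℤ) < α := by exact_mod_cast hα
  have hbd : ∀ x ∈ D, -(|d (α - 1)| * α) ≤ x := by
    intro x hx
    obtain ⟨p, q, rfl, h0, h1⟩ := exists_rep α β hα hcop x
    rw [hD] at hx
    have h2 : d (α - 1) ≤ d q := hd.antitone (by omega)
    have h3 := neg_abs_le (d (α - 1))
    have h4 : 0 ≤ q * (β : ℤ) := by positivity
    nlinarith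
  obtain ⟨m, hm1, hm2⟩ := Int.exists_least_of_bdd (P := fun x => x ∈ D) ⟨_, hbd⟩
    ⟨d 0 * α + 0 * β, (hD _ _).2 le_rfl⟩
  have hR : RR α β {x | x + m ∈ D} m d := by
    intro p q
    rw [← hD]
    simp
  have hN : IsNormalizedSemimodule α β {x | x + m ∈ D} := by
    refine ⟨by simpa using hm1, fun x hx => ?_, ?_⟩
    · have := hm2 _ hx
      omega
    · rintro x hx _ ⟨p', q', rfl⟩
      obtain ⟨p, q, he, h⟩ := hx
      refine ⟨p + p', q + q', by linear_combination he, ?_⟩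
      have : d (q + q') ≤ d q := hd.antitone (by omega)
      omega
  refine ⟨_, m, hN, ?_, hR⟩
  rw [selfdual_iff α β hα hcop _ hN]
  exact ⟨_, RR_symm hα hcop hd hR⟩

/-- the canonical set of minimal generators -/
def MG (α β : ℕ) (Δ : Set ℤ) : Set ℤ := {x | x ∈ Δ ∧ x - α ∉ Δ ∧ x - β ∉ Δ}

lemma MG_sub {α β : ℕ} {Δ : Set ℤ} (hΔ : IsNormalizedSemimodule α β Δ) (E : Set ℤ)
    (hE : E ⊆ Δ) (hgen : (⋃ x ∈ E, (fun γ => x + γ) '' Gamma α β) = Δ) : MG α β Δ ⊆ E := by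
  rintro x ⟨h1, h2, h3⟩
  have hx := h1
  rw [← hgen] at hx
  simp only [Set.mem_iUnion, Set.mem_image] at hx
  obtain ⟨e, he, γ, ⟨p, q, rfl⟩, rfl⟩ := hx
  rcases Nat.eq_zero_or_pos p with rfl | hp
  · rcases Nat.eq_zero_or_pos q with rfl | hq
    · simpa using he
    · exfalso
      apply h3
      obtain ⟨q, rfl⟩ := Nat.exists_eq_succ_of_ne_zero hq.ne'
      have := hΔ.2.2 e (hE he) _ ⟨0, q, rfl⟩
      convert this using 1
      push_cast; ring
  · exfalso
    apply h2
    obtain ⟨p, rfl⟩ := Nat.exists_eq_succ_of_ne_zero hp.ne'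
    have := hΔ.2.2 e (hE he) _ ⟨p, q, rfl⟩
    convert this using 1
    push_cast; ring

lemma MG_gen {α β : ℕ} (hα : 0 < α) (hβ : 0 < β) {Δ : Set ℤ} (hΔ : IsNormalizedSemimodule α β Δ) :
    (⋃ x ∈ MG α β Δ, (fun γ => x + γ) '' Gamma α β) = Δ := by
  apply Set.Subset.antisymm
  · intro y hy
    simp only [Set.mem_iUnion, Set.mem_image] at hy
    obtain ⟨e, he, γ, hγ, rfl⟩ := hy
    exact hΔ.2.2 e he.1 γ hγ
  · have key : ∀ n : ℕ, ∀ y ∈ Δ, y = n → ∃ e ∈ MG α β Δ, ∃ p q : ℕ, y = e + (p * α + q * β) := by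
      intro n
      induction n using Nat.strong_induction_on with
      | _ n ih =>
        intro y hy hyn
        by_cases h1 : y - α ∈ Δ
        · have h0 := hΔ.2.1 _ h1
          obtain ⟨e, he, p, q, h⟩ := ih (n - α) (by omega) _ h1 (by omega)
          exact ⟨e, he, p + 1, q, by push_cast; linear_combination h⟩
        · by_cases h2 : y - β ∈ Δ
          · have h0 := hΔ.2.1 _ h2
            obtain ⟨e, he, p, q, h⟩ := ih (n - β) (by omega) _ h2 (by omega)
            exact ⟨e, he, p, q + 1, by push_cast; linear_combination h⟩
          · exact ⟨y, ⟨hy, h1, h2⟩, 0, 0, by simp⟩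
    intro y hy
    obtain ⟨e, he, p, q, h⟩ := key y.toNat y hy (by rw [Int.toNat_of_nonneg (hΔ.2.1 _ hy)])
    simp only [Set.mem_iUnion, Set.mem_image]
    exact ⟨e, he, _, ⟨p, q, rfl⟩, h.symm⟩

lemma minGen_iff {α β : ℕ} (hα : 0 < α) (hβ : 0 < β) {Δ : Set ℤ} (hΔ : IsNormalizedSemimodule α β Δ)
    (M : Finset ℤ) (hM : (M : Set ℤ) = MG α β Δ) (E : Finset ℤ) : IsMinGenSet α β Δ E ↔ E = M := by
  constructor
  · rintro ⟨h1, h2, h3⟩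
    have hsub : M ⊆ E := by
      rw [← Finset.coe_subset, hM]
      exact MG_sub hΔ _ h1 h2
    by_contra hne
    refine h3 M (Finset.ssubset_iff_subset_ne.2 ⟨hsub, fun h => hne h.symm⟩) ?_
    rw [hM]
    exact MG_gen hα hβ hΔ
  · rintro rfl
    refine ⟨?_, ?_, ?_⟩
    · rw [hM]; exact fun x hx => hx.1
    · rw [hM]; exact MG_gen hα hβ hΔ
    · intro F hF hgen
      have hFΔ : (F : Set ℤ) ⊆ Δ := by
        refine (Finset.coe_subset.2 hF.1).trans ?_
        rw [hM]; exact fun x hx => hx.1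
      have := MG_sub hΔ _ hFΔ hgen
      rw [← hM, Finset.coe_subset] at this
      exact hF.2 this

/-- number of descents of `d` in a period -/
def gens (α : ℕ) (d : ℤ → ℤ) : ℕ := ((Finset.range α).filter (fun q : ℕ => d q < d ((q : ℤ) - 1))).card

lemma gens_iff {α β : ℕ} (hα : 0 < α) (hβ : 0 < β) (hcop : Nat.Coprime α β) {Δ : Set ℤ}
    (hΔ : IsNormalizedSemimodule α β Δ) {t : ℤ} {d : ℤ → ℤ}
    (hR : RR α β Δ t d) (k : ℕ) :
    (∃ E : Finset ℤ, IsMinGenSet α β Δ E ∧ E.card = k) ↔ gens α d = k := by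
  set M : Finset ℤ := ((Finset.range α).filter (fun q : ℕ => d q < d ((q : ℤ) - 1))).image
    (fun q : ℕ => d q * α + q * β - t) with hMdef
  have hM : (M : Set ℤ) = MG α β Δ := by
    ext x
    simp only [hMdef, Finset.coe_image, Set.mem_image, Finset.coe_filter, Finset.mem_range,
      Set.mem_ofPred_eq, MG]
    have hmem : ∀ p q : ℤ, (p * α + q * β - t ∈ Δ ∧ p * α + q * β - t - α ∉ Δ ∧ p * α + q * β - t - β ∉ Δ)
        ↔ p = d q ∧ d q < d (q - 1) := by
      intro p q
      rw [show p * (α : ℤ) + q * β - t - α = (p - 1) * α + q * β - t by ring,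
        show p * (α : ℤ) + q * β - t - β = p * α + (q - 1) * β - t by ring, hR, hR, hR]
      omega
    constructor
    · rintro ⟨q, ⟨h1, h2⟩, rfl⟩
      rw [hmem]
      exact ⟨rfl, h2⟩
    · intro h
      obtain ⟨p, q, hpq, h0, h1⟩ := exists_rep α β hα hcop (x + t)
      have e1 : x = p * α + q * β - t := by linarith
      rw [e1, hmem] at h
      lift q to ℕ using h0
      exact ⟨q, ⟨by omega, h.2⟩, by rw [e1, h.1]⟩
  have hcard : M.card = gens α d := by
    rw [hMdef, Finset.card_image_of_injOn]
    · rfl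
    · intro q hq q' hq' h
      simp only [Finset.coe_filter, Finset.mem_range, Set.mem_ofPred_eq] at hq hq'
      have h' : d q * α + (q : ℤ) * β = d q' * α + (q' : ℤ) * β := by
        simp only at h
        linarith
      obtain ⟨k, hk, -⟩ := rep_eq α β hα hcop _ _ _ _ h'
      have h1 : k < 1 := by
        by_contra hc
        have : 1 * (α : ℤ) ≤ k * α := mul_le_mul_of_nonneg_right (by omega) (by omega)
        omega
      have h2 : -1 < k := by
        by_contra hc
        have : k * (α : ℤ) ≤ (-1) * α := mul_le_mul_of_nonneg_right (by omega) (by omega)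
        omega
      have : k = 0 := by omega
      subst this
      omega
  constructor
  · rintro ⟨E, hE, rfl⟩
    rw [minGen_iff hα hβ hΔ M hM] at hE
    rw [hE, hcard]
  · rintro rfl
    exact ⟨M, (minGen_iff hα hβ hΔ M hM M).2 rfl, hcard⟩

/-- relation between boundary function and sequence of increments; here `a = n + 1` -/
def TT (n : ℕ) (d : ℤ → ℤ) (c : ℕ → ℕ) : Prop :=
  ∀ i : ℕ, i ≤ n → d i = ((∑ j ∈ Finset.Ico i (n+1), c j : ℕ) : ℤ)

lemma TT_last {n : ℕ} {d : ℤ → ℤ} {c : ℕ → ℕ} (h : TT n d c) : (c n : ℤ) = d n := by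
  rw [h n le_rfl]; simp

lemma TT_step {n : ℕ} {d : ℤ → ℤ} {c : ℕ → ℕ} (h : TT n d c) (j : ℕ) (hj : j < n) :
    (c j : ℤ) = d j - d ((j : ℤ) + 1) := by
  have h1 := h j hj.le
  have h2 := h (j+1) hj
  rw [Finset.sum_eq_sum_Ico_succ_bot (by omega)] at h1
  push_cast at h1 h2
  rw [h1, h2]; ring

lemma d_mid {n b : ℕ} {d : ℤ → ℤ} (hd : IsS (2 * (n+1)) (2*b+1) d) : d ((n : ℤ) + 1) = - d n := by
  have h1 := hd.sym n
  have h2 := hd.per (-1 - n)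
  rw [h1] at h2
  rw [show (-1 - (n : ℤ)) + ((2 * (n+1) : ℕ) : ℤ) = n + 1 by push_cast; ring] at h2
  rw [h2]; ring

lemma exists_c {n b : ℕ} {d : ℤ → ℤ} (hd : IsS (2 * (n+1)) (2*b+1) d) :
    ∃ c ∈ BB (n+1) b, TT n d c := by
  have hmid := d_mid hd
  have h0 : 0 ≤ d n := by have := hd.anti n; omega
  let c : ℕ → ℕ := fun j => if j < n then (d j - d ((j : ℤ) + 1)).toNat else if j = n then (d n).toNat else 0
  have hT : ∀ k : ℕ, ∀ i : ℕ, i + k = n → d i = ((∑ j ∈ Finset.Ico i (n+1), c j : ℕ) : ℤ) := by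
    intro k
    induction k with
    | zero =>
      intro i hi
      have : i = n := by omega
      subst this
      simp [c, h0]
    | succ k ih =>
      intro i hi
      rw [Finset.sum_eq_sum_Ico_succ_bot (by omega)]
      have h1 := ih (i+1) (by omega)
      have h2 : (c i : ℤ) = d i - d ((i : ℤ) + 1) := by
        have := hd.anti i
        simp only [c, show i < n by omega, if_true]
        rw [Int.toNat_of_nonneg (by omega)]
      push_cast at h1 ⊢
      rw [h2, ← h1]; ring
  have hTT : TT n d c := fun i hi => hT (n - i) i (by omega)
  refine ⟨c, ⟨?_, ?_⟩, hTT⟩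
  · intro j hj
    simp only [c]
    rw [if_neg (by omega), if_neg (by omega)]
  · have h1 := hTT 0 (Nat.zero_le _)
    have h2 := hd.sym 0
    have h3 := hd.anti (-1)
    simp only [Nat.Ico_zero_eq_range, Nat.cast_zero] at h1
    norm_num at h2 h3
    rw [h2, h1] at h3
    omega

lemma c_unique {n b : ℕ} {d : ℤ → ℤ} {c c' : ℕ → ℕ} (hc : c ∈ BB (n+1) b) (hc' : c' ∈ BB (n+1) b)
    (h : TT n d c) (h' : TT n d c') : c = c' := by
  funext j
  rcases lt_trichotomy j n with hj | rfl | hj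
  · have h1 := TT_step h j hj
    have h2 := TT_step h' j hj
    omega
  · have h1 := TT_last h
    have h2 := TT_last h'
    omega
  · rw [hc.1 j hj, hc'.1 j hj]

lemma d_unique' {n b : ℕ} {d d' : ℤ → ℤ} {c : ℕ → ℕ} (hd : IsS (2 * (n+1)) (2*b+1) d)
    (hd' : IsS (2 * (n+1)) (2*b+1) d') (h : TT n d c) (h' : TT n d' c) : d = d' := by
  have h1 : ∀ q : ℤ, 0 ≤ q → q ≤ n → d q = d' q := by
    intro q h0 h1
    lift q to ℕ using h0
    rw [h q (by omega), h' q (by omega)]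
  have h2 : ∀ q : ℤ, -1 - n ≤ q → q ≤ n → d q = d' q := by
    intro q h0 h3
    by_cases hq : 0 ≤ q
    · exact h1 q hq h3
    · have e1 := hd.sym (-1 - q)
      have e2 := hd'.sym (-1 - q)
      rw [h1 (-1 - q) (by omega) (by omega), ← e2] at e1
      simpa using e1
  funext q
  have hpos : (0 : ℤ) < ((2 * (n+1) : ℕ) : ℤ) := by push_cast; omega
  set A : ℤ := ((2 * (n+1) : ℕ) : ℤ) with hA
  have hr0 := Int.emod_nonneg (q + (n + 1)) hpos.ne'
  have hr1 := Int.emod_lt_of_pos (q + (n + 1)) hpos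
  have hr2 := Int.emod_add_mul_ediv (q + (n + 1)) A
  have e : q = ((q + (n + 1)) % A - (n + 1)) + ((q + (n+1)) / A) * A := by
    linear_combination -hr2
  rw [e, hd.perk, hd'.perk, h2 _ (by omega) (by push_cast at hA; omega)]

lemma exists_d' {n b : ℕ} {c : ℕ → ℕ} (hc : c ∈ BB (n+1) b) :
    ∃ d, IsS (2 * (n+1)) (2*b+1) d ∧ TT n d c := by
  let f : ℤ → ℤ := fun i => ((∑ j ∈ Finset.Ico i.toNat (n+1), c j : ℕ) : ℤ)
  have hf0 : ∀ i, 0 ≤ f i := fun i => Int.natCast_nonneg _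
  have hfa : ∀ i j, i ≤ j → f j ≤ f i := by
    intro i j hij
    simp only [f]
    norm_cast
    apply Finset.sum_le_sum_of_subset
    apply Finset.Ico_subset_Ico_left
    omega
  have hfb : f 0 ≤ b := by
    have := hc.2
    simp only [f, Int.toNat_zero, Nat.Ico_zero_eq_range]
    exact_mod_cast this
  have hpos : (0 : ℤ) < 2 * ((n : ℤ) + 1) := by omega
  let g : ℤ → ℤ → ℤ := fun r k => (if r ≤ n then f r else - f (2 * n + 1 - r)) - k * (2 * b + 1)
  let d : ℤ → ℤ := fun q => g (q % (2 * ((n : ℤ) + 1))) (q / (2 * ((n : ℤ) + 1)))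
  have hdg : ∀ r k, 0 ≤ r → r < 2 * ((n : ℤ) + 1) → d (r + k * (2 * ((n : ℤ) + 1))) = g r k := by
    intro r k h0 h1
    simp only [d]
    rw [Int.add_mul_emod_self_right, Int.emod_eq_of_lt h0 h1, Int.add_mul_ediv_right _ _ hpos.ne',
      Int.ediv_eq_zero_of_lt h0 h1, zero_add]
  have hrep : ∀ q : ℤ, ∃ r k, 0 ≤ r ∧ r < 2 * ((n : ℤ) + 1) ∧ q = r + k * (2 * ((n : ℤ) + 1)) := by
    intro q
    refine ⟨q % (2 * ((n : ℤ) + 1)), q / (2 * ((n : ℤ) + 1)), Int.emod_nonneg _ hpos.ne',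
      Int.emod_lt_of_pos _ hpos, ?_⟩
    linear_combination -(Int.emod_add_mul_ediv q (2 * ((n : ℤ) + 1)))
  refine ⟨d, ⟨?_, ?_, ?_⟩, ?_⟩
  · intro q
    obtain ⟨r, k, h0, h1, rfl⟩ := hrep q
    rw [hdg r k h0 h1]
    by_cases hr : r + 1 < 2 * ((n : ℤ) + 1)
    · rw [show r + k * (2 * ((n : ℤ) + 1)) + 1 = (r + 1) + k * (2 * ((n : ℤ) + 1)) by ring,
        hdg _ _ (by omega) hr]
      simp only [g]
      have := hfa r (r+1) (by omega)
      have := hfa (2 * n + 1 - (r+1)) (2 * n + 1 - r) (by omega)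
      have := hf0 r
      have := hf0 (2 * n + 1 - (r+1))
      split_ifs <;> omega
    · have hr' : r = 2 * n + 1 := by omega
      subst hr'
      rw [show 2 * (n : ℤ) + 1 + k * (2 * ((n : ℤ) + 1)) + 1 = 0 + (k + 1) * (2 * ((n : ℤ) + 1)) by ring,
        hdg _ _ le_rfl hpos]
      simp only [g]
      rw [if_pos (by omega), if_neg (by omega), sub_self]
      have : (k + 1) * (2 * (b : ℤ) + 1) = k * (2 * b + 1) + (2 * b + 1) := by ring
      omega
  · intro q
    obtain ⟨r, k, h0, h1, rfl⟩ := hrep q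
    rw [show r + k * (2 * ((n : ℤ) + 1)) + ((2 * (n+1) : ℕ) : ℤ) = r + (k + 1) * (2 * ((n : ℤ) + 1)) by
      push_cast; ring, hdg _ _ h0 h1, hdg _ _ h0 h1]
    simp only [g]
    push_cast; ring
  · intro q
    obtain ⟨r, k, h0, h1, rfl⟩ := hrep q
    rw [show -1 - (r + k * (2 * ((n : ℤ) + 1))) = (2 * n + 1 - r) + (-k - 1) * (2 * ((n : ℤ) + 1)) by
      ring, hdg _ _ (by omega) (by omega), hdg _ _ h0 h1]
    simp only [g]
    by_cases hr : r ≤ n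
    · rw [if_neg (by omega), if_pos hr]
      push_cast
      rw [show 2 * (n : ℤ) + 1 - (2 * n + 1 - r) = r by ring]; ring
    · rw [if_pos (by omega), if_neg hr]
      push_cast; ring
  · intro i hi
    have := hdg i 0 (by omega) (by omega)
    rw [zero_mul, add_zero] at this
    rw [this]
    simp only [g]
    rw [if_pos (by omega)]
    simp [f]

lemma gens_eq {n b : ℕ} {d : ℤ → ℤ} {c : ℕ → ℕ} (hd : IsS (2 * (n+1)) (2*b+1) d) (h : TT n d c) :
    gens (2 * (n+1)) d = 1 + (if c n ≠ 0 then 1 else 0) + 2 * nz n c := by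
  have hP0 : d (0 : ℤ) < d ((0 : ℤ) - 1) := by
    have h2 := hd.sym 0
    have h3 := hd.anti (-1)
    norm_num at h2 h3 ⊢
    omega
  have hrefl : ∀ q : ℤ, d (2 * (n + 1) - q) < d (2 * (n + 1) - q - 1) ↔ d q < d (q - 1) := by
    intro q
    have e1 := hd.per (-q)
    have e2 := hd.per (-q-1)
    have e3 := hd.sym (q - 1)
    have e4 := hd.sym q
    push_cast at e1 e2
    rw [show -q + 2 * ((n : ℤ) + 1) = 2 * (n + 1) - q by ring, show -q = -1 - (q - 1) by ring, e3] at e1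
    rw [show -q - 1 + 2 * ((n : ℤ) + 1) = 2 * (n + 1) - q - 1 by ring, show -q - 1 = -1 - q by ring, e4] at e2
    rw [e1, e2]
    omega
  have hPn : d ((n : ℤ) + 1) < d n ↔ c n ≠ 0 := by
    have := d_mid hd
    have := TT_last h
    omega
  have hPj : ∀ j < n, d ((j : ℤ) + 1) < d j ↔ c j ≠ 0 := by
    intro j hj
    have := TT_step h j hj
    omega
  set φ : ℕ → ℕ := fun q => if d q < d ((q : ℤ) - 1) then 1 else 0 with hφ
  have hg : gens (2 * (n+1)) d = ∑ q ∈ Finset.range (2 * (n+1)), φ q := by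
    unfold gens
    rw [Finset.card_filter]
  have hz : nz n c = ∑ j ∈ Finset.range n, φ (j+1) := by
    unfold nz
    rw [Finset.card_filter]
    apply Finset.sum_congr rfl
    intro j hj
    have := hPj j (Finset.mem_range.1 hj)
    simp only [hφ]
    push_cast
    rw [add_sub_cancel_right]
    simp only [this]
  have hz2 : ∑ k ∈ Finset.range n, φ (n + 1 + (k + 1)) = ∑ j ∈ Finset.range n, φ (j+1) := by
    rw [← Finset.sum_range_reflect]
    apply Finset.sum_congr rfl
    intro j hj
    have hj := Finset.mem_range.1 hj
    have := hrefl (j + 1)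
    simp only [hφ]
    rw [show ((n + 1 + (n - 1 - j + 1) : ℕ) : ℤ) = 2 * (n + 1) - (j + 1) by omega]
    push_cast
    simp only [this]
  have h0 : φ 0 = 1 := by
    simp only [hφ, Nat.cast_zero]
    rw [if_pos hP0]
  have hn : φ (n+1) = if c n ≠ 0 then 1 else 0 := by
    simp only [hφ]
    push_cast
    rw [add_sub_cancel_right]
    simp only [hPn]
  rw [hg, show 2 * (n + 1) = (n + 1) + (n + 1) by ring, Finset.sum_range_add, Finset.sum_range_succ',
    Finset.sum_range_succ' (fun x => φ (n + 1 + x)), hz2, add_zero, h0, hn, hz]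
  ring

lemma count_gen (n b : ℕ) (hcop : Nat.Coprime (2 * (n+1)) (2*b+1)) (P : Set ℤ → Prop) (Q : (ℕ → ℕ) → Prop)
    (hPQ : ∀ Δ t d c, IsNormalizedSemimodule (2 * (n+1)) (2*b+1) Δ → IsS (2 * (n+1)) (2*b+1) d →
      RR (2 * (n+1)) (2*b+1) Δ t d → TT n d c → (P Δ ↔ Q c)) :
    {Δ : Set ℤ | IsNormalizedSemimodule (2 * (n+1)) (2*b+1) Δ ∧ IsSelfdual (2 * (n+1)) (2*b+1) Δ ∧ P Δ}.ncard =
      {c | c ∈ BB (n+1) b ∧ Q c}.ncard := by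
  have hα : 0 < 2 * (n + 1) := by omega
  refine ncard_eq_of_rel _ _ (fun Δ c => c ∈ BB (n+1) b ∧ ∃ t d, IsS (2 * (n+1)) (2*b+1) d ∧
    RR (2 * (n+1)) (2*b+1) Δ t d ∧ TT n d c) ?_ ?_ ?_ ?_
  · rintro Δ ⟨h1, h2, h3⟩
    obtain ⟨t, d, hd, hR⟩ := exists_d _ _ hα hcop ⟨n+1, by ring⟩ ⟨b, rfl⟩ Δ h1 h2
    obtain ⟨c, hc, hT⟩ := exists_c hd
    exact ⟨c, ⟨hc, (hPQ Δ t d c h1 hd hR hT).1 h3⟩, hc, t, d, hd, hR, hT⟩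
  · rintro c ⟨hc, hq⟩
    obtain ⟨d, hd, hT⟩ := exists_d' hc
    obtain ⟨Δ, t, h1, h2, hR⟩ := exists_Delta hα hcop hd
    exact ⟨Δ, ⟨h1, h2, (hPQ Δ t d c h1 hd hR hT).2 hq⟩, hc, t, d, hd, hR, hT⟩
  · rintro Δ ⟨h1, -, -⟩ c c' ⟨hc, t, d, hd, hR, hT⟩ ⟨hc', t', d', hd', hR', hT'⟩
    have := d_unique hα hcop h1 hd hR hd' hR'
    subst this
    exact c_unique hc hc' hT hT'
  · rintro Δ ⟨h1, -, -⟩ Δ' ⟨h1', -, -⟩ c ⟨hc, t, d, hd, hR, hT⟩ ⟨hc', t', d', hd', hR', hT'⟩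
    have := d_unique' hd hd' hT hT'
    subst this
    exact Delta_unique hα hcop h1 h1' hR hR'

/-- If `α` is even and `β` is odd: (i) the total number of selfdual semimodules is
`C(α/2 + (β-1)/2, α/2)`; (ii) for `0 ≤ ℓ ≤ α/2 - 1` there are
`C(α/2 - 1, ℓ) · C((β-1)/2, ℓ)` selfdual semimodules with `2ℓ + 1` minimal
generators; (iii) for `1 ≤ ℓ ≤ α/2` there are `C(α/2 - 1, ℓ - 1) · C((β-1)/2, ℓ)`
selfdual semimodules with `2ℓ` minimal generators. -/
theorem count_selfdual_even_odd (α β : ℕ)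
    (hα : 2 ≤ α) (hαβ : α < β) (hcop : Nat.Coprime α β)
    (hαeven : Even α) (hβodd : Odd β) :
    ({Δ : Set ℤ | IsNormalizedSemimodule α β Δ ∧ IsSelfdual α β Δ}.ncard =
        Nat.choose (α / 2 + (β - 1) / 2) (α / 2)) ∧
    (∀ ℓ : ℕ, ℓ ≤ α / 2 - 1 →
      {Δ : Set ℤ | IsNormalizedSemimodule α β Δ ∧ IsSelfdual α β Δ ∧
          ∃ E : Finset ℤ, IsMinGenSet α β Δ E ∧ E.card = 2 * ℓ + 1}.ncard =
        Nat.choose (α / 2 - 1) ℓ * Nat.choose ((β - 1) / 2) ℓ) ∧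
    (∀ ℓ : ℕ, 1 ≤ ℓ → ℓ ≤ α / 2 →
      {Δ : Set ℤ | IsNormalizedSemimodule α β Δ ∧ IsSelfdual α β Δ ∧
          ∃ E : Finset ℤ, IsMinGenSet α β Δ E ∧ E.card = 2 * ℓ}.ncard =
        Nat.choose (α / 2 - 1) (ℓ - 1) * Nat.choose ((β - 1) / 2) ℓ) := by
  obtain ⟨a, rfl⟩ := hαeven
  obtain ⟨b, rfl⟩ := hβodd
  obtain ⟨n, rfl⟩ : ∃ n, a = n + 1 := ⟨a - 1, by omega⟩
  rw [← two_mul] at hcop ⊢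
  have e1 : 2 * (n + 1) / 2 = n + 1 := by omega
  have e2 : (2 * b + 1 - 1) / 2 = b := by omega
  rw [e1, e2, Nat.add_sub_cancel]
  have hg : ∀ k, ∀ Δ t d c, IsNormalizedSemimodule (2 * (n+1)) (2*b+1) Δ → IsS (2 * (n+1)) (2*b+1) d →
      RR (2 * (n+1)) (2*b+1) Δ t d → TT n d c →
      ((∃ E : Finset ℤ, IsMinGenSet (2 * (n+1)) (2*b+1) Δ E ∧ E.card = k) ↔
        1 + (if c n ≠ 0 then 1 else 0) + 2 * nz n c = k) := by
    intro k Δ t d c h1 hd hR hT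
    rw [gens_iff (by omega) (by omega) hcop h1 hR, gens_eq hd hT]
  refine ⟨?_, ?_, ?_⟩
  · have := count_gen n b hcop (fun _ => True) (fun _ => True) (by simp)
    simp only [and_true] at this
    rw [this, ← BB_card]
    rfl
  · intro l _
    rw [count_gen n b hcop _ _ (hg (2 * l + 1)), ← AA_card]
    congr 1
    ext c
    constructor
    · rintro ⟨h1, h2⟩
      have h0 : c n = 0 := by
        by_contra h0
        rw [if_pos h0] at h2
        omega
      rw [if_neg (by simpa using h0)] at h2
      exact ⟨(BB_zero_last n b c h0).1 h1, by omega⟩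
    · rintro ⟨h1, h2⟩
      have h0 := h1.1 n le_rfl
      refine ⟨(BB_zero_last n b c h0).2 h1, ?_⟩
      rw [if_neg (by simpa using h0)]
      omega
  · intro l hl _
    obtain ⟨l, rfl⟩ : ∃ m, l = m + 1 := ⟨l - 1, by omega⟩
    rw [count_gen n b hcop _ _ (hg (2 * (l + 1))), Nat.add_sub_cancel, ← JJ_card]
    congr 1
    ext c
    constructor
    · rintro ⟨h1, h2⟩
      have h0 : c n ≠ 0 := by
        intro h0
        rw [if_neg (by simpa using h0)] at h2
        omega
      rw [if_pos h0] at h2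
      refine ⟨h1, ?_, h0⟩
      rw [nz_succ, if_pos h0]
      omega
    · rintro ⟨h1, h2, h0⟩
      rw [nz_succ, if_pos h0] at h2
      refine ⟨h1, ?_⟩
      rw [if_pos h0]
      omega
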